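/- If E = ℤ^d, the set E⁽⁰⁾ has density one at infinity: lim_{R → ∞} #(E⁽⁰⁾ ∩ B_R(0)) / #(ℤ^d ∩ B_R(0)) = 1, where B_R(0) := {ξ ∈ ℝ^d : ‖ξ‖ ≤ R} is the ball of radius R for the norm induced by g*. -/

import Mathlib

/-- A positive definite symmetric bilinear form on `ℝ^d`. -/
structure PDForm (d : ℕ) where
  B : (Fin d → ℝ) →ₗ[ℝ] (Fin d → ℝ) →ₗ[ℝ] ℝ
  symm : ∀ x y, B x y = B y x
  posdef : ∀ x, x ≠ 0 → 0 < B x x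

namespace PDForm

variable {d : ℕ} (g : PDForm d)

/-- The inner product `⟨·,·⟩` associated with the form. -/
def inn (x y : Fin d → ℝ) : ℝ := g.B x y

/-- The norm `‖·‖` associated with the form. -/
noncomputable def nrm (x : Fin d → ℝ) : ℝ := Real.sqrt (g.inn x x)

/-- The Japanese bracket `⟨x⟩ = (1+‖x‖²)^{1/2}`. -/
noncomputable def jap (x : Fin d → ℝ) : ℝ := Real.sqrt (1 + g.inn x x)

end PDForm

/-- Cast of a lattice vector of `ℤ^d` into `ℝ^d`. -/
def zc {d : ℕ} (k : Fin d → ℤ) : Fin d → ℝ := fun i => (k i : ℝ)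

/-- `𝔠 := min{‖k‖² : k ∈ ℤ^d, k ≠ 0}`. -/
noncomputable def frakc {d : ℕ} (g : PDForm d) : ℝ :=
  sInf {x | ∃ k : Fin d → ℤ, k ≠ 0 ∧ x = (g.nrm (zc k)) ^ 2}

/-- Gram volume `√det(⟨u_i,u_j⟩)` of an `s`-tuple of vectors. -/
noncomputable def gvol {d s : ℕ} (g : PDForm d) (u : Fin s → (Fin d → ℝ)) : ℝ :=
  Real.sqrt (Matrix.det (Matrix.of fun i j => g.inn (u i) (u j)))

/-- `𝔉`, the minimal Gram volume of parallelepipeds with linearly independent integer edges. -/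
noncomputable def frakC {d : ℕ} (g : PDForm d) : ℝ :=
  sInf {x | ∃ (s : ℕ) (u : Fin s → (Fin d → ℤ)), 1 ≤ s ∧ s ≤ d ∧
    LinearIndependent ℝ (fun j => zc (u j)) ∧ x = gvol g (fun j => zc (u j))}

/-- A submodule of `ℤ^d` in the sense of the paper: `span_ℝ(M) ∩ ℤ^d = M`. -/
def IsSat {d : ℕ} (M : Submodule ℤ (Fin d → ℤ)) : Prop :=
  ∀ k : Fin d → ℤ, zc k ∈ Submodule.span ℝ (zc '' (M : Set (Fin d → ℤ))) → k ∈ M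

/-- The dimension (rank) of a submodule of `ℤ^d`. -/
noncomputable def zrank {d : ℕ} (M : Submodule ℤ (Fin d → ℤ)) : ℕ := Module.finrank ℤ M

/-- `ξ_k := ξ + κ + k/2`. -/
noncomputable def xik {d : ℕ} (κ : Fin d → ℝ) (ξ k : Fin d → ℤ) : Fin d → ℝ :=
  fun i => (ξ i : ℝ) + κ i + (k i : ℝ) / 2

/-- Conditions on the parameters `δ, ε, τ`. -/
def ParamsOK (d : ℕ) (δ ε τ : ℝ) : Prop :=
  1 ≤ d ∧ 0 < δ ∧ δ < 1 ∧ 0 < ε ∧ (d : ℝ) - 1 < τ ∧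
    δ + d * ((d + τ + 1) * ε) < 1 ∧ ε * (τ + 1) ≤ δ

/-- The integer points of the cube `[-t, t]^d`. -/
noncomputable def latticeBox (d : ℕ) (t : ℝ) : Finset (Fin d → ℤ) :=
  Fintype.piFinset fun _ => Finset.Icc (-⌊t⌋) ⌊t⌋

theorem mem_latticeBox {d : ℕ} {t : ℝ} {ξ : Fin d → ℤ} :
    ξ ∈ latticeBox d t ↔ ∀ i, |(ξ i : ℝ)| ≤ t := by
  simp only [latticeBox, Fintype.mem_piFinset, Finset.mem_Icc]
  refine forall_congr' fun i => ?_
  rw [abs_le, neg_le (a := ⌊t⌋), Int.le_floor, Int.le_floor]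
  push_cast
  rw [neg_le (a := t)]

theorem mem_latticeBox_iff_norm {d : ℕ} {t : ℝ} (ht : 0 ≤ t) {ξ : Fin d → ℤ} :
    ξ ∈ latticeBox d t ↔ ‖zc ξ‖ ≤ t := by
  rw [mem_latticeBox, pi_norm_le_iff_of_nonneg ht]
  rfl

theorem card_Icc_floor {t : ℝ} (ht : 0 ≤ t) :
    ((Finset.Icc (-⌊t⌋) ⌊t⌋).card : ℝ) = 2 * ⌊t⌋ + 1 := by
  have h : 0 ≤ ⌊t⌋ := Int.floor_nonneg.2 ht
  have h' : ((Finset.Icc (-⌊t⌋) ⌊t⌋).card : ℤ) = 2 * ⌊t⌋ + 1 := by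
    rw [Int.card_Icc, Int.toNat_of_nonneg (by lia)]
    ring
  exact_mod_cast h'

theorem card_Icc_floor_le {t : ℝ} (ht : 0 ≤ t) :
    ((Finset.Icc (-⌊t⌋) ⌊t⌋).card : ℝ) ≤ 2 * t + 1 := by
  rw [card_Icc_floor ht]
  linarith [Int.floor_le t]

theorem card_latticeBox_le (d : ℕ) {t : ℝ} (ht : 0 ≤ t) :
    ((latticeBox d t).card : ℝ) ≤ (2 * t + 1) ^ d := by
  simp only [latticeBox, Fintype.card_piFinset_const, Nat.cast_pow]
  exact pow_le_pow_left₀ (by positivity) (card_Icc_floor_le ht) d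

theorem le_card_latticeBox (d : ℕ) {t : ℝ} (ht : 0 ≤ t) :
    t ^ d ≤ ((latticeBox d t).card : ℝ) := by
  simp only [latticeBox, Fintype.card_piFinset_const, Nat.cast_pow]
  refine pow_le_pow_left₀ ht ?_ d
  rw [card_Icc_floor ht]
  have h : (0 : ℝ) ≤ ⌊t⌋ := by exact_mod_cast Int.floor_nonneg.2 ht
  linarith [Int.lt_floor_add_one t]

theorem card_int_le_of_forall_sub_le {s : Finset ℤ} {L : ℝ} (hL : 0 ≤ L)
    (h : ∀ x ∈ s, ∀ y ∈ s, (x : ℝ) - y ≤ L) : (s.card : ℝ) ≤ L + 1 := by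
  rcases s.eq_empty_or_nonempty with rfl | hs
  · simp only [Finset.card_empty, Nat.cast_zero]
    linarith
  have hsub : s ⊆ Finset.Icc (s.min' hs) (s.min' hs + ⌊L⌋) := by
    intro x hx
    refine Finset.mem_Icc.2 ⟨s.min'_le x hx, ?_⟩
    have : x - s.min' hs ≤ ⌊L⌋ := by
      rw [Int.le_floor]
      push_cast
      exact h x hx _ (s.min'_mem hs)
    lia
  have hcard := Finset.card_le_card hsub
  rw [Int.card_Icc] at hcard
  have h0 : 0 ≤ ⌊L⌋ := Int.floor_nonneg.2 hL
  have h1 : (s.card : ℤ) ≤ ⌊L⌋ + 1 := by lia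
  have h2 : (s.card : ℝ) ≤ ⌊L⌋ + 1 := by exact_mod_cast h1
  linarith [Int.floor_le L]

/-- A slab `|ℓ + b| ≤ T`, with `ℓ` a linear form that is at least `c` in some coordinate direction,
contains few points of a lattice box. -/
theorem card_latticeBox_slab_le {n : ℕ} {t T c b : ℝ} (ht : 0 ≤ t) (hT : 0 ≤ T) (hc : 0 < c)
    (ℓ : (Fin (n + 1) → ℝ) →ₗ[ℝ] ℝ) (i : Fin (n + 1)) (hi : c ≤ |ℓ (Pi.single i 1)|) :
    (((latticeBox (n + 1) t).filter fun ξ => |ℓ (zc ξ) + b| ≤ T).card : ℝ) ≤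
      (2 * t + 1) ^ n * (2 * T / c + 1) := by
  classical
  set s := (latticeBox (n + 1) t).filter fun ξ => |ℓ (zc ξ) + b| ≤ T with hs
  have hfib : ∀ η ∈ latticeBox n t,
      ((s.filter fun ξ => i.removeNth ξ = η).card : ℝ) ≤ 2 * T / c + 1 := by
    intro η _
    have hinj : Set.InjOn (fun ξ : Fin (n + 1) → ℤ => ξ i)
        (s.filter fun ξ => i.removeNth ξ = η) := by
      intro x hx y hy hxy
      simp only [Finset.coe_filter, Set.mem_ofPred_eq] at hx hy
      rw [← i.insertNth_self_removeNth x, ← i.insertNth_self_removeNth y, hx.2, hy.2]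
      exact congrArg (fun a => i.insertNth (α := fun _ => ℤ) a η) hxy
    rw [← Finset.card_image_of_injOn hinj]
    refine card_int_le_of_forall_sub_le (by positivity) ?_
    simp only [Finset.mem_image, Finset.mem_filter, hs]
    rintro _ ⟨x, ⟨⟨-, hx⟩, hxη⟩, rfl⟩ _ ⟨y, ⟨⟨-, hy⟩, hyη⟩, rfl⟩
    have hdiff : zc x - zc y = ((x i : ℝ) - y i) • Pi.single i 1 := by
      ext j
      rcases Fin.eq_self_or_eq_succAbove i j with rfl | ⟨j, rfl⟩
      · simp [zc]
      · have := congrFun (hxη.trans hyη.symm) j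
        simp only [Fin.removeNth] at this
        simp [zc, this]
    have hℓ : ℓ (zc x) - ℓ (zc y) = ((x i : ℝ) - y i) * ℓ (Pi.single i 1) := by
      rw [← map_sub, hdiff, map_smul, smul_eq_mul]
    have hle : |(x i : ℝ) - y i| * |ℓ (Pi.single i 1)| ≤ 2 * T := by
      rw [← abs_mul, ← hℓ]
      rw [abs_le] at hx hy ⊢
      constructor <;> linarith
    rw [le_div_iff₀ hc]
    calc ((x i : ℝ) - y i) * c ≤ |(x i : ℝ) - y i| * c := by gcongr; exact le_abs_self _
      _ ≤ |(x i : ℝ) - y i| * |ℓ (Pi.single i 1)| := by gcongr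
      _ ≤ 2 * T := hle
  have hmaps : ∀ ξ ∈ s, i.removeNth ξ ∈ latticeBox n t := by
    intro ξ hξ
    rw [hs, Finset.mem_filter, mem_latticeBox] at hξ
    exact mem_latticeBox.2 fun j => hξ.1 _
  rw [Finset.card_eq_sum_card_fiberwise hmaps]
  push_cast
  refine (Finset.sum_le_sum hfib).trans ?_
  rw [Finset.sum_const, nsmul_eq_mul]
  gcongr
  exact card_latticeBox_le n ht

namespace PDForm

variable {d : ℕ} (g : PDForm d)

theorem inn_self_nonneg (x : Fin d → ℝ) : 0 ≤ g.inn x x := by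
  rcases eq_or_ne x 0 with rfl | h
  · simp [inn]
  · exact (g.posdef x h).le

theorem nrm_nonneg (x : Fin d → ℝ) : 0 ≤ g.nrm x := Real.sqrt_nonneg _

theorem nrm_sq (x : Fin d → ℝ) : g.nrm x ^ 2 = g.inn x x := Real.sq_sqrt (g.inn_self_nonneg x)

theorem jap_sq (x : Fin d → ℝ) : g.jap x ^ 2 = 1 + g.inn x x :=
  Real.sq_sqrt (by linarith [g.inn_self_nonneg x])

theorem one_le_jap (x : Fin d → ℝ) : 1 ≤ g.jap x :=
  Real.one_le_sqrt.2 (by linarith [g.inn_self_nonneg x])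

theorem inn_add_self_le (x y : Fin d → ℝ) :
    g.inn (x + y) (x + y) ≤ 2 * g.inn x x + 2 * g.inn y y := by
  have h := g.inn_self_nonneg (x - y)
  simp only [inn, map_add, map_sub, LinearMap.add_apply, LinearMap.sub_apply] at h ⊢
  linarith

theorem continuous_inn_self : Continuous fun x => g.inn x x := by
  have h : Continuous fun x : Fin d → ℝ => LinearMap.toContinuousLinearMap (g.B x) :=
    ((LinearMap.toContinuousLinearMap (𝕜 := ℝ) (E := Fin d → ℝ) (F' := ℝ)).toLinearMap ∘ₗ
      g.B).continuous_of_finiteDimensional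
  exact h.clm_apply continuous_id

/-- The norm of a positive definite form is equivalent to the sup norm. -/
theorem exists_norm_equiv (hd : 1 ≤ d) :
    ∃ a b : ℝ, 0 < a ∧ 0 < b ∧ ∀ x, g.nrm x ≤ a * ‖x‖ ∧ ‖x‖ ≤ b * g.nrm x := by
  have : Nonempty (Fin d) := ⟨⟨0, hd⟩⟩
  have hne : (Metric.sphere (0 : Fin d → ℝ) 1).Nonempty := NormedSpace.sphere_nonempty.2 zero_le_one
  have hcont : Continuous g.nrm := Real.continuous_sqrt.comp g.continuous_inn_self
  have hK : IsCompact (Metric.sphere (0 : Fin d → ℝ) 1) := isCompact_sphere _ _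
  obtain ⟨u, hu, hmin⟩ := hK.exists_isMinOn hne hcont.continuousOn
  obtain ⟨v, hv, hmax⟩ := hK.exists_isMaxOn hne hcont.continuousOn
  have hpos : ∀ w ∈ Metric.sphere (0 : Fin d → ℝ) 1, 0 < g.nrm w := by
    intro w hw
    refine Real.sqrt_pos.2 (g.posdef w ?_)
    rintro rfl
    simp at hw
  have hscale : ∀ (r : ℝ) (x : Fin d → ℝ), 0 ≤ r → g.nrm (r • x) = r * g.nrm x := by
    intro r x hr
    have : g.inn (r • x) (r • x) = r ^ 2 * g.inn x x := by
      simp only [inn, map_smul, LinearMap.smul_apply, smul_eq_mul]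
      ring
    rw [nrm, this, Real.sqrt_mul (sq_nonneg r), Real.sqrt_sq hr, nrm]
  refine ⟨g.nrm v, (g.nrm u)⁻¹, hpos v hv, inv_pos.2 (hpos u hu), fun x => ?_⟩
  rcases eq_or_ne x 0 with rfl | hx
  · simp [nrm, inn]
  have hx' : 0 < ‖x‖ := norm_pos_iff.2 hx
  have hmem : ‖x‖⁻¹ • x ∈ Metric.sphere (0 : Fin d → ℝ) 1 := by
    rw [mem_sphere_zero_iff_norm, norm_smul, norm_inv, norm_norm, inv_mul_cancel₀ hx'.ne']
  have h1 : g.nrm u ≤ ‖x‖⁻¹ * g.nrm x := by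
    rw [← hscale _ _ (inv_nonneg.2 hx'.le)]
    exact hmin hmem
  have h2 : ‖x‖⁻¹ * g.nrm x ≤ g.nrm v := by
    rw [← hscale _ _ (inv_nonneg.2 hx'.le)]
    exact hmax hmem
  have hup := hpos u hu
  constructor
  · rwa [inv_mul_le_iff₀ hx', mul_comm] at h2
  · rw [inv_mul_eq_div, le_div_iff₀ hx'] at h1
    rw [inv_mul_eq_div, le_div_iff₀ hup]
    linarith

end PDForm

theorem one_le_norm_zc {d : ℕ} {k : Fin d → ℤ} (hk : k ≠ 0) : 1 ≤ ‖zc k‖ := by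
  obtain ⟨i, hi⟩ := Function.ne_iff.1 hk
  refine le_trans ?_ (norm_le_pi_norm (zc k) i)
  rw [Real.norm_eq_abs, zc]
  exact_mod_cast Int.one_le_abs hi

/-- A nonzero lattice vector pairs nontrivially with some coordinate vector, uniformly. -/
theorem PDForm.exists_le_abs_inn_single {n : ℕ} (g : PDForm (n + 1)) {b : ℝ} (hb : 0 < b)
    (h : ∀ x, ‖x‖ ≤ b * g.nrm x) {k : Fin (n + 1) → ℤ} (hk : k ≠ 0) :
    ∃ i, (b ^ 2 * (n + 1))⁻¹ ≤ |g.inn (Pi.single i 1) (zc k)| := by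
  by_contra! hlt
  have h1 := one_le_norm_zc hk
  have hsum : g.inn (zc k) (zc k) = ∑ i, zc k i * g.inn (Pi.single i 1) (zc k) := by
    have hk' := congrArg (fun x => g.B x (zc k)) (pi_eq_sum_univ' (zc k))
    simp only [map_sum, map_smul, LinearMap.sum_apply, LinearMap.smul_apply, smul_eq_mul] at hk'
    exact hk'
  have hlt' : g.inn (zc k) (zc k) < ∑ _i : Fin (n + 1), ‖zc k‖ * (b ^ 2 * (n + 1))⁻¹ := by
    rw [hsum]
    refine Finset.sum_lt_sum_of_nonempty Finset.univ_nonempty fun i _ => ?_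
    calc zc k i * g.inn (Pi.single i 1) (zc k)
        ≤ |zc k i| * |g.inn (Pi.single i 1) (zc k)| := by
          rw [← abs_mul]; exact le_abs_self _
      _ ≤ ‖zc k‖ * |g.inn (Pi.single i 1) (zc k)| := by
          gcongr; exact norm_le_pi_norm (zc k) i
      _ < _ := by gcongr; exact hlt i
  have hsq : ‖zc k‖ ^ 2 ≤ b ^ 2 * g.inn (zc k) (zc k) := by
    rw [← g.nrm_sq, ← mul_pow]
    exact pow_le_pow_left₀ (norm_nonneg _) (h _) 2
  have hconst : ∑ _i : Fin (n + 1), ‖zc k‖ * (b ^ 2 * (n + 1) : ℝ)⁻¹ = ‖zc k‖ / b ^ 2 := by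
    simp only [Finset.sum_const, Finset.card_univ, Fintype.card_fin, nsmul_eq_mul]
    push_cast
    field_simp
  rw [hconst, lt_div_iff₀ (by positivity)] at hlt'
  nlinarith

theorem PDForm.jap_xik_le {d : ℕ} (g : PDForm d) (κ : Fin d → ℝ) {ε R : ℝ} (hε : ε ≤ 1)
    (hR : 0 ≤ R) (hκ : 8 * g.inn κ κ + 2 ≤ 8 * R ^ 2) {ξ k : Fin d → ℤ} (hξ : g.nrm (zc ξ) ≤ R)
    (hk : g.nrm (zc k) ≤ g.jap (xik κ ξ k) ^ ε) : g.jap (xik κ ξ k) ≤ 4 * R := by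
  have hJ := g.one_le_jap (xik κ ξ k)
  have hkJ : g.nrm (zc k) ≤ g.jap (xik κ ξ k) :=
    hk.trans ((Real.rpow_le_rpow_of_exponent_le hJ hε).trans_eq (Real.rpow_one _))
  have hx : xik κ ξ k = (zc ξ + κ) + (1 / 2 : ℝ) • zc k := by
    ext i
    simp only [xik, zc, Pi.add_apply, Pi.smul_apply, smul_eq_mul]
    ring
  have h1 := g.inn_add_self_le (zc ξ + κ) ((1 / 2 : ℝ) • zc k)
  have h2 := g.inn_add_self_le (zc ξ) κ
  have h3 : g.inn ((1 / 2 : ℝ) • zc k) ((1 / 2 : ℝ) • zc k) = g.nrm (zc k) ^ 2 / 4 := by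
    rw [g.nrm_sq]
    simp only [PDForm.inn, map_smul, LinearMap.smul_apply, smul_eq_mul]
    ring
  have h4 := g.jap_sq (xik κ ξ k)
  rw [← hx, h3] at h1
  rw [← g.nrm_sq (zc ξ)] at h2
  have h5 := pow_le_pow_left₀ (g.nrm_nonneg _) hξ 2
  have h6 := pow_le_pow_left₀ (g.nrm_nonneg _) hkJ 2
  refine (pow_le_pow_iff_left₀ (zero_le_one.trans hJ) (by positivity) two_ne_zero).1 ?_
  nlinarith

/-- The lattice points satisfying a resonance relation of order at most `⟨ξ_k⟩^ε`. -/
def resonantSet {d : ℕ} (g : PDForm d) (κ : Fin d → ℝ) (δ ε τ : ℝ) : Set (Fin d → ℤ) :=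
  {ξ | ∃ k : Fin d → ℤ, k ≠ 0 ∧ g.nrm (zc k) ≤ g.jap (xik κ ξ k) ^ ε ∧
    |g.inn (xik κ ξ k) (zc k)| ≤ g.jap (xik κ ξ k) ^ δ * g.nrm (zc k) ^ (-τ)}

theorem ncard_resonantSet_le {n : ℕ} (g : PDForm (n + 1)) (κ : Fin (n + 1) → ℝ) {δ ε τ b R : ℝ}
    (hδ : 0 ≤ δ) (hε₀ : 0 ≤ ε) (hε : ε ≤ 1) (hτ : 0 ≤ τ) (hb : 0 < b)
    (hnorm : ∀ x, ‖x‖ ≤ b * g.nrm x) (hR : 0 ≤ R) (hκ : 8 * g.inn κ κ + 2 ≤ 8 * R ^ 2) :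
    ((resonantSet g κ δ ε τ ∩ {ξ | g.nrm (zc ξ) ≤ R}).ncard : ℝ) ≤
      (2 * (b * (4 * R) ^ ε) + 1) ^ (n + 1) * ((2 * (b * R) + 1) ^ n *
        (2 * ((4 * R) ^ δ * b ^ τ) / (b ^ 2 * (n + 1))⁻¹ + 1)) := by
  classical
  set T := (4 * R) ^ δ * b ^ τ with hT
  set slab : (Fin (n + 1) → ℤ) → Finset (Fin (n + 1) → ℤ) := fun k =>
    (latticeBox (n + 1) (b * R)).filter fun ξ =>
      |g.B.flip (zc k) (zc ξ) + g.inn (κ + (1 / 2 : ℝ) • zc k) (zc k)| ≤ T with hslab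
  set K := (latticeBox (n + 1) (b * (4 * R) ^ ε)).filter fun k => k ≠ 0 with hK
  have hsub : resonantSet g κ δ ε τ ∩ {ξ | g.nrm (zc ξ) ≤ R} ⊆ ↑(K.biUnion slab) := by
    rintro ξ ⟨⟨k, hk0, hk, hres⟩, hξ⟩
    replace hξ : g.nrm (zc ξ) ≤ R := hξ
    have hJ := g.jap_xik_le κ hε hR hκ hξ hk
    have hJ0 : 0 ≤ g.jap (xik κ ξ k) := zero_le_one.trans (g.one_le_jap _)
    have hbk : b⁻¹ ≤ g.nrm (zc k) := by
      rw [inv_le_iff_one_le_mul₀' hb]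
      exact (one_le_norm_zc hk0).trans (hnorm _)
    have hx : xik κ ξ k = zc ξ + (κ + (1 / 2 : ℝ) • zc k) := by
      ext i
      simp only [xik, zc, Pi.add_apply, Pi.smul_apply, smul_eq_mul]
      ring
    simp only [Finset.coe_biUnion, Set.mem_iUnion, Finset.mem_coe, hK, hslab, Finset.mem_filter]
    refine ⟨k, ⟨(mem_latticeBox_iff_norm (by positivity)).2 ((hnorm _).trans ?_), hk0⟩,
      (mem_latticeBox_iff_norm (by positivity)).2 ((hnorm _).trans ?_), ?_⟩
    · gcongr
      exact hk.trans (Real.rpow_le_rpow hJ0 hJ hε₀)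
    · gcongr
    · have hinn : g.B.flip (zc k) (zc ξ) + g.inn (κ + (1 / 2 : ℝ) • zc k) (zc k) =
          g.inn (xik κ ξ k) (zc k) := by
        rw [hx, PDForm.inn, PDForm.inn, LinearMap.flip_apply, map_add g.B (zc ξ),
          LinearMap.add_apply]
      rw [hinn]
      refine hres.trans (mul_le_mul (Real.rpow_le_rpow hJ0 hJ hδ) ?_
        (Real.rpow_nonneg (g.nrm_nonneg _) _) (by positivity))
      calc g.nrm (zc k) ^ (-τ) ≤ b⁻¹ ^ (-τ) :=
            Real.rpow_le_rpow_of_nonpos (by positivity) hbk (by linarith)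
        _ = b ^ τ := by rw [Real.rpow_neg (by positivity), Real.inv_rpow hb.le, inv_inv]
  have hslab_card : ∀ k ∈ K, ((slab k).card : ℝ) ≤
      (2 * (b * R) + 1) ^ n * (2 * T / (b ^ 2 * (n + 1))⁻¹ + 1) := by
    intro k hk
    obtain ⟨i, hi⟩ := g.exists_le_abs_inn_single hb hnorm (Finset.mem_filter.1 hk).2
    exact card_latticeBox_slab_le (by positivity) (by positivity) (by positivity)
      (g.B.flip (zc k)) i hi
  calc ((resonantSet g κ δ ε τ ∩ {ξ | g.nrm (zc ξ) ≤ R}).ncard : ℝ)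
      ≤ ((K.biUnion slab).card : ℝ) := by
        rw [← Set.ncard_coe_finset]
        exact_mod_cast Set.ncard_le_ncard hsub (Finset.finite_toSet _)
    _ ≤ ∑ k ∈ K, ((slab k).card : ℝ) := by exact_mod_cast Finset.card_biUnion_le
    _ ≤ K.card * ((2 * (b * R) + 1) ^ n * (2 * T / (b ^ 2 * (n + 1))⁻¹ + 1)) := by
        rw [← nsmul_eq_mul, ← Finset.sum_const]
        exact Finset.sum_le_sum hslab_card
    _ ≤ _ := by
        gcongr
        refine le_trans ?_ (card_latticeBox_le (n + 1) (by positivity))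
        exact_mod_cast Finset.card_filter_le _ _

theorem finite_nrm_le {d : ℕ} (g : PDForm d) {b : ℝ} (hb : 0 < b)
    (hnorm : ∀ x, ‖x‖ ≤ b * g.nrm x) (R : ℝ) : {ξ : Fin d → ℤ | g.nrm (zc ξ) ≤ R}.Finite := by
  refine (latticeBox d (b * R)).finite_toSet.subset fun ξ hξ => ?_
  have hle : b * g.nrm (zc ξ) ≤ b * R := by gcongr; exact hξ
  have hR : 0 ≤ b * R := (mul_nonneg hb.le (g.nrm_nonneg _)).trans hle
  exact (mem_latticeBox_iff_norm hR).2 ((hnorm _).trans hle)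

theorem le_ncard_nrm_le {d : ℕ} (g : PDForm d) {a R : ℝ} (ha : 0 < a)
    (hnorm : ∀ x, g.nrm x ≤ a * ‖x‖) (hR : 0 ≤ R)
    (hfin : {ξ : Fin d → ℤ | g.nrm (zc ξ) ≤ R}.Finite) :
    (R / a) ^ d ≤ ({ξ : Fin d → ℤ | g.nrm (zc ξ) ≤ R}.ncard : ℝ) := by
  have hRa : 0 ≤ R / a := by positivity
  refine (le_card_latticeBox d hRa).trans ?_
  rw [← Set.ncard_coe_finset]
  refine Nat.cast_le.2 (Set.ncard_le_ncard (fun ξ hξ => ?_) hfin)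
  have hξ' := (mem_latticeBox_iff_norm hRa).1 hξ
  rw [le_div_iff₀ ha, mul_comm] at hξ'
  exact (hnorm _).trans hξ'

theorem rpow_linear_add_one_le {c s R : ℝ} (hs : 0 ≤ s) (hR : 1 ≤ R) :
    c * (4 * R) ^ s + 1 ≤ (c * 4 ^ s + 1) * R ^ s := by
  rw [Real.mul_rpow (by norm_num) (by linarith)]
  linarith [Real.one_le_rpow hR hs]

theorem tendsto_resonantSet_density {d : ℕ} {δ ε τ : ℝ} (hpar : ParamsOK d δ ε τ) (g : PDForm d)
    (κ : Fin d → ℝ) :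
    Filter.Tendsto (fun R : ℝ =>
      ((resonantSet g κ δ ε τ ∩ {ξ | g.nrm (zc ξ) ≤ R}).ncard : ℝ) /
        ({ξ : Fin d → ℤ | g.nrm (zc ξ) ≤ R}.ncard : ℝ)) Filter.atTop (nhds 0) := by
  obtain ⟨hd, hδ, -, hε, hτ, hsum, -⟩ := hpar
  obtain ⟨a, b, ha, hb, hab⟩ := g.exists_norm_equiv hd
  obtain ⟨n, rfl⟩ : ∃ n, d = n + 1 := ⟨d - 1, by lia⟩
  push_cast at hτ hsum
  have hn : (0 : ℝ) ≤ n := n.cast_nonneg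
  have hτ₀ : 0 < τ := by linarith
  have hdε : (n + 1 : ℝ) * ε ≤ (n + 1) * ((n + 1 + τ + 1) * ε) := by
    have : 0 ≤ (n + 1 + τ) * ε := by positivity
    gcongr
    linarith
  have hε₁ : ε ≤ 1 := by nlinarith
  set C₁ := 2 * b * 4 ^ ε + 1 with hC₁
  set C₂ := 2 * b + 1 with hC₂
  set C₃ := 2 * b ^ τ / (b ^ 2 * (n + 1))⁻¹ * 4 ^ δ + 1 with hC₃
  set C := C₁ ^ (n + 1) * (C₂ ^ n * C₃) * a ^ (n + 1) with hC
  set s := 1 - ((n + 1) * ε + δ) with hs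
  have hlim : Filter.Tendsto (fun R : ℝ => C * R ^ (-s)) Filter.atTop (nhds 0) := by
    simpa using (tendsto_rpow_neg_atTop (y := s) (by linarith)).const_mul C
  refine tendsto_of_tendsto_of_tendsto_of_le_of_le' tendsto_const_nhds hlim
    (Filter.Eventually.of_forall fun R => by positivity) ?_
  filter_upwards [Filter.eventually_ge_atTop 1,
    Filter.eventually_ge_atTop (8 * g.inn κ κ + 2)] with R hR hRκ
  have hR₀ : 0 < R := by linarith
  have hκ : 8 * g.inn κ κ + 2 ≤ 8 * R ^ 2 := by nlinarith
  have hnum := ncard_resonantSet_le g κ hδ.le hε.le hε₁ hτ₀.le hb (fun x => (hab x).2) hR₀.le hκ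
  have hden := le_ncard_nrm_le g ha (fun x => (hab x).1) hR₀.le
    (finite_nrm_le g hb (fun x => (hab x).2) R)
  have h₁ : 2 * (b * (4 * R) ^ ε) + 1 ≤ C₁ * R ^ ε := by
    rw [← mul_assoc]
    exact rpow_linear_add_one_le hε.le hR
  have h₂ : 2 * (b * R) + 1 ≤ C₂ * R := by
    rw [hC₂]
    linarith
  have h₃ : 2 * ((4 * R) ^ δ * b ^ τ) / (b ^ 2 * (n + 1))⁻¹ + 1 ≤ C₃ * R ^ δ := by
    refine le_trans (le_of_eq ?_) (rpow_linear_add_one_le hδ.le hR)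
    ring
  have hnum' : ((resonantSet g κ δ ε τ ∩ {ξ | g.nrm (zc ξ) ≤ R}).ncard : ℝ) ≤
      (C₁ * R ^ ε) ^ (n + 1) * ((C₂ * R) ^ n * (C₃ * R ^ δ)) :=
    hnum.trans (by gcongr)
  have hpow : (R ^ ε) ^ (n + 1) * (R ^ n * R ^ δ) = R ^ (-s) * R ^ (n + 1) := by
    rw [← Real.rpow_natCast (R ^ ε), ← Real.rpow_natCast R n, ← Real.rpow_natCast R (n + 1),
      ← Real.rpow_mul hR₀.le, ← Real.rpow_add hR₀, ← Real.rpow_add hR₀, ← Real.rpow_add hR₀, hs]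
    congr 1
    push_cast
    ring
  calc ((resonantSet g κ δ ε τ ∩ {ξ | g.nrm (zc ξ) ≤ R}).ncard : ℝ) /
        ({ξ : Fin (n + 1) → ℤ | g.nrm (zc ξ) ≤ R}.ncard : ℝ)
      ≤ (C₁ * R ^ ε) ^ (n + 1) * ((C₂ * R) ^ n * (C₃ * R ^ δ)) / (R / a) ^ (n + 1) := by
        gcongr
    _ = C₁ ^ (n + 1) * (C₂ ^ n * C₃) * a ^ (n + 1) *
          ((R ^ ε) ^ (n + 1) * (R ^ n * R ^ δ)) / R ^ (n + 1) := by
        rw [div_pow, mul_pow, mul_pow]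
        field_simp
    _ = C * R ^ (-s) := by
        rw [hpow, hC]
        field_simp

/-- If `E = ℤ^d`, the completely nonresonant set `E⁽⁰⁾ = Z⁽⁰⁾` has density
one at infinity: `#(E⁽⁰⁾ ∩ B_R)/#(ℤ^d ∩ B_R) → 1` as `R → ∞`. -/
theorem statement6 (d : ℕ) (δ ε τ : ℝ) (hpar : ParamsOK d δ ε τ)
    (g : PDForm d) (κ : Fin d → ℝ) :
    Filter.Tendsto (fun R : ℝ =>
        (Nat.card {ξ : Fin d → ℤ |
            (∀ k : Fin d → ℤ, k ≠ 0 →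
              g.nrm (zc k) ≤ (g.jap (xik κ ξ k)) ^ ε →
              |g.inn (xik κ ξ k) (zc k)| >
                (g.jap (xik κ ξ k)) ^ δ * (g.nrm (zc k)) ^ (-τ)) ∧
            g.nrm (zc ξ) ≤ R} : ℝ) /
          (Nat.card {ξ : Fin d → ℤ | g.nrm (zc ξ) ≤ R} : ℝ))
      Filter.atTop (nhds 1) := by
  obtain ⟨a, b, -, hb, hab⟩ := g.exists_norm_equiv hpar.1
  refine (sub_zero (1 : ℝ) ▸ (tendsto_resonantSet_density hpar g κ).const_sub 1).congr' ?_
  filter_upwards [Filter.eventually_ge_atTop 0] with R hR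
  have hfin := finite_nrm_le g hb (fun x => (hab x).2) R
  have hpos : 0 < ({ξ : Fin d → ℤ | g.nrm (zc ξ) ≤ R}.ncard : ℝ) := by
    refine Nat.cast_pos.2 ((Set.ncard_pos hfin).2 ⟨0, ?_⟩)
    have h0 : zc (0 : Fin d → ℤ) = 0 := by
      ext i
      simp [zc]
    simpa [h0, PDForm.nrm, PDForm.inn] using hR
  have hset : {ξ : Fin d → ℤ |
      (∀ k : Fin d → ℤ, k ≠ 0 →
        g.nrm (zc k) ≤ (g.jap (xik κ ξ k)) ^ ε →
        |g.inn (xik κ ξ k) (zc k)| >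
          (g.jap (xik κ ξ k)) ^ δ * (g.nrm (zc k)) ^ (-τ)) ∧
      g.nrm (zc ξ) ≤ R} = {ξ | g.nrm (zc ξ) ≤ R} \ resonantSet g κ δ ε τ := by
    ext ξ
    simp only [resonantSet, Set.mem_sdiff, Set.mem_ofPred_eq, not_exists, not_and, not_le, gt_iff_lt]
    exact and_comm
  have hcard := Set.ncard_inter_add_ncard_sdiff_eq_ncard
    {ξ : Fin d → ℤ | g.nrm (zc ξ) ≤ R} (resonantSet g κ δ ε τ) hfin
  rw [Set.inter_comm] at hcard
  rw [hset, Nat.card_coe_set_eq, Nat.card_coe_set_eq, eq_div_iff hpos.ne', sub_mul, one_mul,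
    div_mul_cancel₀ _ hpos.ne', ← hcard]
  push_cast
  ring
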